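/- arXiv:1909.13869 — 2 statements merged into one kernel-verified Lean document; each statement's English description precedes it below -/
import Mathlib

section
/- With L2(u) := [u] ⊗ [1 − u] − [1 − u] ⊗ [u] ∈ V_F^{⊗2} and a ⊙ b := a ⊗ b + b ⊗ a for a, b ∈ V_F, the following two identities hold in V_F^{⊗4}: (1) Alt_8[ L2(ρ_{2,4}/ρ_{3,4}) ⊗ ( [ρ_4/ρ_1] ⊙ [ρ_{3,2}/ρ_{3,4}] − 2·[ρ_{3,2}/ρ_{3,4}] ⊙ [ρ_2/ρ_{2,1}] + 3·[ρ_{1,2}] ⊙ [ρ_4/ρ_1] ) ] = 2·Alt_8[ L2(ρ_1/ρ_2) ⊗ ( [ρ_1/ρ_{1,2}] ⊙ [ρ_{3,2}] ) ]; (2) Alt_8[ L2(ρ_{2,4}/ρ_{3,4}) ⊗ ( −[ρ_2/ρ_{2,1}] ⊙ [ρ_1/ρ_{1,2}] ) + L2(ρ_1/ρ_2) ⊗ ( (1/2)·[ρ_{3,4}] ⊙ [ρ_{3,4}] − (1/2)·[ρ_{3,2}] ⊙ [ρ_{3,2}] ) ] = 0. -/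
open scoped TensorProduct
open PiTensorProduct

attribute [local instance] Classical.propDecidable

set_option maxHeartbeats 1000000
set_option synthInstance.maxHeartbeats 400000

noncomputable section

namespace GrassPoly

variable (F : Type) [Field F]

/-- `V_F = F^× ⊗_ℤ ℚ` as a `ℚ`-vector space. -/
abbrev VF : Type := ℚ ⊗[ℤ] (Additive Fˣ)

variable {F}

/-- The class `[a]` of a nonzero field element in `V_F` (defined to be `0` for `a = 0`). -/
def cls (a : F) : VF F :=
  if h : a = 0 then 0 else (1 : ℚ) ⊗ₜ[ℤ] (Additive.ofMul (Units.mk0 a h))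

variable (F) in
/-- Tensor powers of V_F over ℚ. -/
abbrev TP (n : ℕ) : Type := ⨂[ℚ]^n (VF F)

instance instTPAddCommGroup (n : ℕ) : AddCommGroup (TP F n) :=
  Module.addCommMonoidToAddCommGroup ℚ

/-- Appending one extra tensor factor on the right. -/
def snoc {n : ℕ} : TP F n →ₗ[ℚ] VF F →ₗ[ℚ] TP F (n + 1) :=
  PiTensorProduct.lift
    ((PiTensorProduct.tprod ℚ (s := fun _ : Fin (n + 1) => VF F)).curryRight)

/-- The factor `t_i` appearing in the recursive definition of the symbol,
as a function of `(a_{i-1}, a_i, a_{i+1})`. -/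
def tCoef (p a q : F) : VF F :=
  if p = a then (if a = q then 0 else cls (q - a))
  else if a = q then - cls (p - a)
  else cls ((q - a) / (p - a))

/-- The symbol `S I(a₀; a₁, …, a_m; a_{m+1})`, with the middle entries given as a list
(of length `n`). -/
def SIaux : (n : ℕ) → (a0 : F) → (as : List F) → (b : F) → as.length = n → TP F n
  | 0, _, _, _, _ => tprod ℚ (fun i : Fin 0 => i.elim0)
  | n + 1, a0, as, b, h =>
      ∑ i : Fin (n + 1),
        snoc (SIaux n a0 (as.eraseIdx i.val) b
            (by
              have hi' := i.isLt
              have hi : i.val < as.length := by omega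
              have h2 := List.length_eraseIdx_of_lt hi
              omega))
          (tCoef ((a0 :: as).getD i.val 0) (as.getD i.val 0) ((as ++ [b]).getD (i.val + 1) 0))

/-- Cyclic rotation `b₁ ⊗ … ⊗ b_N ↦ b₂ ⊗ … ⊗ b_N ⊗ b₁` on tensor powers. -/
def rotN (n : ℕ) : TP F n ≃ₗ[ℚ] TP F n :=
  PiTensorProduct.reindex ℚ (fun _ : Fin n => VF F) (finRotate n).symm

/-- Splitting off the last tensor factor. -/
def splitLast (n : ℕ) : TP F (n + 1) ≃ₗ[ℚ] (TP F n) ⊗[ℚ] (VF F) :=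
  ((PiTensorProduct.reindex ℚ (fun _ : Fin (n + 1) => VF F)
      (finSumFinEquiv (m := n) (n := 1)).symm).trans
    (PiTensorProduct.tmulEquiv ℚ (VF F)).symm).trans
    (TensorProduct.congr (LinearEquiv.refl ℚ _)
      (PiTensorProduct.subsingletonEquiv (0 : Fin 1)))

/-- The projector `Π̃_N` annihilating symbols of products. -/
def Pit : (n : ℕ) → TP F n →ₗ[ℚ] TP F n
  | 0 => LinearMap.id
  | 1 => LinearMap.id
  | (n + 2) =>
      ((splitLast (n + 1)).symm.toLinearMap
        ∘ₗ TensorProduct.map (Pit (n + 1)) LinearMap.id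
        ∘ₗ (splitLast (n + 1)).toLinearMap)
      ∘ₗ ((LinearMap.id : TP F (n + 2) →ₗ[ℚ] TP F (n + 2)) - (rotN (F := F) (n + 2)).toLinearMap)

/-- The map on `V_F` induced by a field automorphism. -/
def vmap (φ : F ≃+* F) : VF F →ₗ[ℚ] VF F :=
  TensorProduct.AlgebraTensorModule.map (LinearMap.id : ℚ →ₗ[ℚ] ℚ)
    (AddMonoidHom.toIntLinearMap
      { toFun := fun a => Additive.ofMul ((Units.map (φ : F →* F)) a.toMul)
        map_zero' := by simp
        map_add' := by intro a b; simp [_root_.map_mul] })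

/-- The induced map on tensor powers. -/
def tpMap {n : ℕ} (φ : F ≃+* F) : TP F n →ₗ[ℚ] TP F n :=
  PiTensorProduct.map (fun _ => vmap φ)


/-! ### Symbols of (multiple) polylogarithms -/

/-- Symbol of `Li₂`. -/
def SLi2 (x : F) : TP F 2 := - SIaux 2 0 [x⁻¹, 0] 1 rfl

/-- Symbol of `Li₃`. -/
def SLi3 (x : F) : TP F 3 := - SIaux 3 0 [x⁻¹, 0, 0] 1 rfl

/-- Symbol of `Li₄`. -/
def SLi4 (x : F) : TP F 4 := - SIaux 4 0 [x⁻¹, 0, 0, 0] 1 rfl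

/-- Symbol of `Li₅`. -/
def SLi5 (x : F) : TP F 5 := - SIaux 5 0 [x⁻¹, 0, 0, 0, 0] 1 rfl

/-- Symbol of `I_{3,1}(x,y) = I(0; x,0,0,y; 1)`. -/
def SI31 (x y : F) : TP F 4 := SIaux 4 0 [x, 0, 0, y] 1 rfl

/-- Symbol of `I_{4,1}(x,y) = I(0; x,0,0,0,y; 1)`. -/
def SI41 (x y : F) : TP F 5 := SIaux 5 0 [x, 0, 0, 0, y] 1 rfl

/-- Symbol of `I⁺_{4,1}(x,y) = ½ (I_{4,1}(x,y) + I_{4,1}(x,y⁻¹))`. -/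
def I41p (x y : F) : TP F 5 := (2 : ℚ)⁻¹ • (SI41 x y + SI41 x y⁻¹)

/-- The anharmonic orbit of `x`, together with the signs of the
corresponding permutations in `S₃`. -/
def anhList (x : F) : List (ℚ × F) :=
  [(1, x), (1, (1 - x)⁻¹), (1, 1 - x⁻¹), (-1, x⁻¹), (-1, 1 - x), (-1, x / (x - 1))]

/-- Symbol of `Ĩ_{3,1}(x,y) = (1/36) Σ_{σ,π ∈ S₃} sgn(σ) sgn(π) I_{3,1}(x^σ, y^π)`. -/
def tI31 (x y : F) : TP F 4 :=
  (36 : ℚ)⁻¹ •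
    ((anhList x).map (fun p =>
      ((anhList y).map (fun q => (p.1 * q.1) • SI31 p.2 q.2)).sum)).sum

/-- Symbol of `Ĩ⁺_{4,1}(x,y) = (1/6) Σ_{σ ∈ S₃} sgn(σ) I⁺_{4,1}(x^σ, y)`. -/
def tI41p (x y : F) : TP F 5 :=
  (6 : ℚ)⁻¹ • ((anhList x).map (fun p => p.1 • I41p p.2 y)).sum

/-- Symbol of `V(z; x, y) = Ĩ_{3,1}(z, [x]+[y]+[(1-x)/(1-xy)]+[1-xy]+[(1-y)/(1-xy)])`. -/
def Vc (z x y : F) : TP F 4 :=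
  tI31 z x + tI31 z y + tI31 z ((1 - x) / (1 - x * y)) + tI31 z (1 - x * y)
    + tI31 z ((1 - y) / (1 - x * y))

/-- `Sym₃₆(a,b) := I_{3,1}(a,b) - Ĩ_{3,1}(a,b)` (on the level of symbols). -/
def S36 (a b : F) : TP F 4 := SI31 a b - tI31 a b

/-! ### Generic vectors -/

variable (N m : ℕ)

/-- Polynomial ring on the entries of `N` generic vectors in `m`-space. -/
abbrev Pol : Type := MvPolynomial (Fin N × Fin m) ℚ

/-- The field of rational functions in the entries of `N` generic vectors in `m`-space. -/
abbrev FF : Type := FractionRing (Pol N m)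

/-- The `j`-th coordinate of the `i`-th generic vector. -/
def gen (i : Fin N) (j : Fin m) : FF N m :=
  algebraMap (Pol N m) (FF N m) (MvPolynomial.X (i, j))

/-- `⟨i₁ … i_m⟩`: the determinant of the matrix whose columns are
the generic vectors selected by `cols`. -/
def dets (cols : Fin m → Fin N) : FF N m :=
  (Matrix.of fun r c => gen N m (cols c) r).det

/-- The field automorphism of `FF N m` induced by a permutation of the `N` vectors. -/
def permAut (σ : Equiv.Perm (Fin N)) : FF N m ≃+* FF N m :=
  IsFractionRing.ringEquivOfRingEquiv
    ((MvPolynomial.renameEquiv ℚ (σ.prodCongr (Equiv.refl (Fin m)))).toRingEquiv)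

variable {N m}

/-- Skew-symmetrization over all permutations of the `N` generic vectors. -/
def Alt {n : ℕ} (x : TP (FF N m) n) : TP (FF N m) n :=
  ∑ σ : Equiv.Perm (Fin N), (((Equiv.Perm.sign σ : ℤˣ) : ℤ) : ℚ) • tpMap (permAut N m σ) x

end GrassPoly

end

namespace GrassPoly

noncomputable section W4

/-- The field of rational functions in the entries of 8 generic vectors in 4-space. -/
abbrev K4 : Type := FF 8 4

/-- The vector label `k ∈ {1, …, 8}` as an index. -/
def L8 (k : ℕ) : Fin 8 := ⟨(k - 1) % 8, Nat.mod_lt _ (by norm_num)⟩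

/-- `⟨abcd⟩` for vector labels in `{1, …, 8}`. -/
def d4 (a b c d : ℕ) : K4 := dets 8 4 ![L8 a, L8 b, L8 c, L8 d]

/-- Vector labels taken mod 6 in `{1, …, 6}`. -/
def M6 (j : ℕ) : ℕ := (j - 1) % 6 + 1

/-- `ρ_i = ρ_{i,i+1,i+2} = ⟨i,i+1,i+2,7⟩ / ⟨i,i+1,i+2,8⟩`, indices mod 6. -/
def rho (i : ℕ) : K4 :=
  d4 (M6 i) (M6 (i + 1)) (M6 (i + 2)) 7 / d4 (M6 i) (M6 (i + 1)) (M6 (i + 2)) 8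

/-- `ρ_{i,j} = ρ_i - ρ_j`. -/
def rr (i j : ℕ) : K4 := rho i - rho j

/-- The projected cross-ratio `CR(ab|cdef) = ⟨abce⟩⟨abdf⟩ / (⟨abcf⟩⟨abde⟩)`. -/
def CR (a b c d e f : ℕ) : K4 :=
  (d4 a b c e * d4 a b d f) / (d4 a b c f * d4 a b d e)

/-- The symbol `S(Gr₄) = 2·(4!)²·Alt₈ [⟨1234⟩ ⊗ ⟨2345⟩ ⊗ ⟨3456⟩ ⊗ ⟨4567⟩]`. -/
def SGr4 : TP K4 4 :=
  ((2 : ℚ) * ((Nat.factorial 4 : ℚ)) ^ 2) •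
    Alt (tprod ℚ ![cls (d4 1 2 3 4), cls (d4 2 3 4 5), cls (d4 3 4 5 6), cls (d4 4 5 6 7)])

/-- An elementary tensor in `V_F^{⊗4}`. -/
def tp4 (a b c d : VF K4) : TP K4 4 := tprod ℚ ![a, b, c, d]

end W4

end GrassPoly

open GrassPoly

namespace GrassPoly

/-- `L2(u) ⊗ [a] ⊗ [b] - (u ↔ 1-u)`: the summand of `L2(u) ⊗ ([a] ⊙ [b])`. -/
noncomputable def lt2 (u a b : K4) : TP K4 4 :=
  tp4 (cls u) (cls (1 - u)) (cls a) (cls b) - tp4 (cls (1 - u)) (cls u) (cls a) (cls b)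

/-- `L2(u) ⊗ ([a] ⊙ [b])` where `L2(u) = [u]⊗[1-u] - [1-u]⊗[u]` and `⊙` is the
symmetrized tensor. -/
noncomputable def lodot (u a b : K4) : TP K4 4 := lt2 u a b + lt2 u b a

end GrassPoly


noncomputable section

namespace GrassPoly

section Classes

variable {F : Type} [Field F]

lemma cls_of_ne_zero {a : F} (h : a ≠ 0) :
    cls a = (1 : ℚ) ⊗ₜ[ℤ] (Additive.ofMul (Units.mk0 a h)) := dif_neg h

lemma cls_mul {a b : F} (ha : a ≠ 0) (hb : b ≠ 0) : cls (a * b) = cls a + cls b := by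
  rw [cls_of_ne_zero ha, cls_of_ne_zero hb, cls_of_ne_zero (mul_ne_zero ha hb),
    ← TensorProduct.tmul_add, ← ofMul_mul, Units.mk0_mul]

lemma cls_one : cls (1 : F) = 0 := by
  have h := cls_mul (one_ne_zero (α := F)) one_ne_zero
  rw [mul_one] at h
  simpa using h

lemma cls_div {a b : F} (ha : a ≠ 0) (hb : b ≠ 0) : cls (a / b) = cls a - cls b := by
  rw [eq_sub_iff_add_eq, ← cls_mul (div_ne_zero ha hb) hb, div_mul_cancel₀ a hb]

lemma cls_neg_one : cls (-1 : F) = 0 := by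
  have h := cls_mul (neg_ne_zero.2 (one_ne_zero (α := F))) (neg_ne_zero.2 one_ne_zero)
  rw [neg_mul_neg, mul_one, cls_one, ← two_smul ℚ] at h
  exact (smul_eq_zero.1 h.symm).resolve_left two_ne_zero

lemma cls_neg (a : F) : cls (-a) = cls a := by
  by_cases h : a = 0
  · rw [h, neg_zero]
  · rw [← neg_one_mul, cls_mul (neg_ne_zero.2 one_ne_zero) h, cls_neg_one, zero_add]

lemma cls_sub_comm (a b : F) : cls (a - b) = cls (b - a) := by
  rw [← neg_sub, cls_neg]

lemma vmap_cls (φ : F ≃+* F) (a : F) : vmap φ (cls a) = cls (φ a) := by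
  by_cases h : a = 0
  · simp [cls, h]
  · have h' : φ a ≠ 0 := by simpa using h
    rw [cls_of_ne_zero h, cls_of_ne_zero h']
    simp only [vmap, TensorProduct.AlgebraTensorModule.map_tmul, LinearMap.id_coe, id_eq]
    congr 1
    apply Additive.toMul.injective
    ext
    simp

lemma tpMap_tprod {n : ℕ} (φ : F ≃+* F) (v : Fin n → VF F) :
    tpMap φ (tprod ℚ v) = tprod ℚ fun i => vmap φ (v i) := by
  simp [tpMap]

lemma vmap_vmap (φ ψ : F ≃+* F) (x : VF F) : vmap φ (vmap ψ x) = vmap (ψ.trans φ) x := by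
  induction x using TensorProduct.induction_on with
  | zero => simp
  | add x y hx hy => simp [hx, hy]
  | tmul r a =>
    simp only [vmap, TensorProduct.AlgebraTensorModule.map_tmul, LinearMap.id_coe, id_eq]
    congr 1

lemma tpMap_tpMap {n : ℕ} (φ ψ : F ≃+* F) (x : TP F n) :
    tpMap φ (tpMap ψ x) = tpMap (ψ.trans φ) x := by
  induction x using PiTensorProduct.induction_on with
  | smul_tprod r v => simp only [map_smul, tpMap_tprod, vmap_vmap]
  | add x y hx hy => simp only [map_add, hx, hy]

end Classes

section GenericVectors

variable {N m : ℕ}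

lemma permAut_gen (σ : Equiv.Perm (Fin N)) (i : Fin N) (j : Fin m) :
    permAut N m σ (gen N m i j) = gen N m (σ i) j := by
  simp [permAut, gen]

lemma permAut_dets (σ : Equiv.Perm (Fin N)) (cols : Fin m → Fin N) :
    permAut N m σ (dets N m cols) = dets N m (σ ∘ cols) := by
  unfold dets
  rw [RingEquiv.map_det]
  congr 1
  ext r c
  simp [permAut_gen]

lemma permAut_trans (σ τ : Equiv.Perm (Fin N)) :
    (permAut N m τ).trans (permAut N m σ) = permAut N m (σ * τ) := by
  have h : ((permAut N m τ).trans (permAut N m σ)).toRingHom = (permAut N m (σ * τ)).toRingHom := by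
    apply IsFractionRing.injective_comp_algebraMap (A := Pol N m)
    apply MvPolynomial.ringHom_ext
    · intro r
      simp [permAut]
    · rintro ⟨i, j⟩
      change permAut N m σ (permAut N m τ (gen N m i j)) = permAut N m (σ * τ) (gen N m i j)
      simp only [permAut_gen, Equiv.Perm.mul_apply]
  ext x
  exact RingHom.congr_fun h x

lemma Alt_tpMap {n : ℕ} (τ : Equiv.Perm (Fin N)) (x : TP (FF N m) n) :
    Alt (tpMap (permAut N m τ) x) = ((Equiv.Perm.sign τ : ℤ) : ℚ) • Alt x := by
  unfold Alt
  rw [Finset.smul_sum]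
  refine Fintype.sum_equiv (Equiv.mulRight τ) _ _ fun σ => ?_
  rw [tpMap_tpMap, permAut_trans, smul_smul]
  congr 1
  rw [Equiv.coe_mulRight, Equiv.Perm.sign_mul]
  rcases Int.units_eq_one_or (Equiv.Perm.sign τ) with h | h <;> simp [h]

/-- Skew-symmetrization as a linear map. -/
def altHom (n : ℕ) : TP (FF N m) n →ₗ[ℚ] TP (FF N m) n :=
  ∑ σ : Equiv.Perm (Fin N), ((Equiv.Perm.sign σ : ℤ) : ℚ) • tpMap (permAut N m σ)

lemma altHom_apply {n : ℕ} (x : TP (FF N m) n) : altHom n x = Alt x := by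
  simp [altHom, Alt]

lemma dets_comp_perm (cols : Fin m → Fin N) (π : Equiv.Perm (Fin m)) :
    dets N m (cols ∘ π) = ((Equiv.Perm.sign π : ℤ) : FF N m) * dets N m cols := by
  unfold dets
  rw [← Matrix.det_permute']
  rfl

lemma cls_dets_comp_perm (cols : Fin m → Fin N) (π : Equiv.Perm (Fin m)) :
    cls (dets N m (cols ∘ π)) = cls (dets N m cols) := by
  rw [dets_comp_perm]
  rcases Int.units_eq_one_or (Equiv.Perm.sign π) with h | h <;> simp [h, cls_neg]

lemma cls_dets_eq_of_range_eq {cols cols' : Fin m → Fin N} (h : Function.Injective cols)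
    (h' : Function.Injective cols') (hr : Set.range cols = Set.range cols') :
    cls (dets N m cols) = cls (dets N m cols') := by
  let π : Equiv.Perm (Fin m) := (Equiv.ofInjective cols h).trans
    ((Equiv.setCongr hr).trans (Equiv.ofInjective cols' h').symm)
  have hπ : cols = cols' ∘ π := by
    funext i
    simp only [π, Function.comp_apply, Equiv.trans_apply, Equiv.apply_ofInjective_symm]
    rfl
  rw [hπ, cls_dets_comp_perm]

/-- The value of a polynomial when the generic vectors lie on the moment curve. -/
def momentEval (N m : ℕ) : Pol N m →+* ℚ :=
  MvPolynomial.eval fun p => (p.1 : ℚ) ^ (p.2 : ℕ)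

/-- The determinant `⟨i₁ … i_m⟩` as a polynomial. -/
def polDets (N m : ℕ) (cols : Fin m → Fin N) : Pol N m :=
  (Matrix.of fun r c => (MvPolynomial.X (cols c, r) : Pol N m)).det

lemma dets_eq_algebraMap (cols : Fin m → Fin N) :
    dets N m cols = algebraMap (Pol N m) (FF N m) (polDets N m cols) := by
  unfold dets polDets
  rw [RingHom.map_det]
  rfl

lemma momentEval_polDets (cols : Fin m → Fin N) :
    momentEval N m (polDets N m cols) = (Matrix.vandermonde fun c => ((cols c : ℕ) : ℚ)).det := by
  unfold polDets
  rw [RingHom.map_det, ← Matrix.det_transpose]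
  congr 1
  ext r c
  simp [momentEval, Matrix.vandermonde]

lemma dets_ne_zero {cols : Fin m → Fin N} (h : Function.Injective cols) : dets N m cols ≠ 0 := by
  rw [dets_eq_algebraMap]
  intro h0
  have h1 := (IsFractionRing.injective (Pol N m) (FF N m)) (h0.trans (map_zero _).symm)
  have h2 := congrArg (momentEval N m) h1
  rw [momentEval_polDets, map_zero] at h2
  refine Matrix.det_vandermonde_ne_zero_iff.2 (fun a b hab => h ?_) h2
  exact Fin.ext (by exact_mod_cast hab)

/-- The class of the bracket whose columns form the set `s`, and `0` if there is
no such bracket. -/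
def br (s : Set (Fin N)) : VF (FF N m) :=
  if h : ∃ cols : Fin m → Fin N, Function.Injective cols ∧ Set.range cols = s then
    cls (dets N m h.choose) else 0

lemma br_range {cols : Fin m → Fin N} (h : Function.Injective cols) :
    br (Set.range cols) = cls (dets N m cols) := by
  have h' : ∃ c : Fin m → Fin N, Function.Injective c ∧ Set.range c = Set.range cols :=
    ⟨cols, h, rfl⟩
  rw [br, dif_pos h']
  exact cls_dets_eq_of_range_eq h'.choose_spec.1 h h'.choose_spec.2

lemma vmap_br (σ : Equiv.Perm (Fin N)) (s : Set (Fin N)) :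
    vmap (permAut N m σ) (br s) = br (σ '' s) := by
  by_cases h : ∃ cols : Fin m → Fin N, Function.Injective cols ∧ Set.range cols = s
  · obtain ⟨cols, hc, rfl⟩ := h
    rw [br_range hc, vmap_cls, permAut_dets, ← Set.range_comp,
      br_range (σ.injective.comp hc)]
  · rw [br, dif_neg h, br, dif_neg, map_zero]
    rintro ⟨cols, hc, hs⟩
    refine h ⟨σ.symm ∘ cols, σ.symm.injective.comp hc, ?_⟩
    rw [Set.range_comp, hs, Set.image_image]
    simp

end GenericVectors

section FormalSums

/-- Formal integral combinations of words, a word being encoded by the list of labels of the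
eight vectors: the `k`-th bit of a label tells whether the vector occurs in the `k`-th letter. -/
abbrev FSum : Type := List (ℤ × List ℕ)

/-- Chaining of signed rewriting steps; `none` stands for zero, `true` for a minus sign. -/
def signedBind (x : Option (Bool × List ℕ)) (f : List ℕ → Option (Bool × List ℕ)) :
    Option (Bool × List ℕ) :=
  match x with
  | none => none
  | some (s, l) => match f l with
    | none => none
    | some (s', l') => some (xor s s', l')

/-- Signed insertion into a sorted list. -/
def insertSgn (a : ℕ) : List ℕ → Option (Bool × List ℕ)
  | [] => some (false, [a])
  | b :: l => bif Nat.blt a b then some (false, a :: b :: l) else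
      bif Nat.blt b a then
        match insertSgn a l with
        | none => none
        | some (s, l') => some (!s, b :: l')
      else none

/-- Signed insertion sort, returning `none` on lists with a repeated entry. -/
def sortSgn : List ℕ → Option (Bool × List ℕ)
  | [] => some (false, [])
  | a :: l => signedBind (sortSgn l) (insertSgn a)

/-- Signed sorting of the entries in positions `k` and `k + 1`. -/
def compareSwap : ℕ → List ℕ → Option (Bool × List ℕ)
  | 0, a :: b :: l => bif Nat.blt a b then some (false, a :: b :: l) else
      bif Nat.blt b a then some (true, b :: a :: l) else none
  | k + 1, a :: l => match compareSwap k l with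
      | none => none
      | some (s, l') => some (s, a :: l')
  | _, l => some (false, l)

/-- Exchange of the pairs in positions `(1, 2)` and `(4, 5)` if they are out of order. -/
def pairSwap : List ℕ → Option (Bool × List ℕ)
  | [x₀, x₁, x₂, x₃, x₄, x₅, x₆, x₇] =>
      bif Nat.blt (16 * x₄ + x₅) (16 * x₁ + x₂) then
        some (false, [x₀, x₄, x₅, x₃, x₁, x₂, x₆, x₇])
      else some (false, [x₀, x₁, x₂, x₃, x₄, x₅, x₆, x₇])
  | l => some (false, l)

/-- Signed normal form under the exchanges of `2, 3`, of `5, 6`, of `7, 8`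
and of the pairs `(2, 3)` and `(5, 6)`. -/
def quadricSgn (l : List ℕ) : Option (Bool × List ℕ) :=
  signedBind (compareSwap 1 l) fun l => signedBind (compareSwap 4 l) fun l =>
    signedBind (compareSwap 6 l) pairSwap

/-- Boolean equality of lists of natural numbers. -/
def listEq : List ℕ → List ℕ → Bool
  | [], [] => true
  | a :: l, b :: l' => Nat.beq a b && listEq l l'
  | _, _ => false

/-- Adding one term to a formal sum. -/
def collect (c : ℤ) (l : List ℕ) : FSum → FSum
  | [] => [(c, l)]
  | (d, m) :: x => bif listEq l m then (c + d, m) :: x else (d, m) :: collect c l x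

/-- Bringing all words of a formal sum into the normal form given by `nf`. -/
def normalForm (nf : List ℕ → Option (Bool × List ℕ)) : FSum → FSum
  | [] => []
  | (c, l) :: x => match nf l with
    | none => normalForm nf x
    | some (s, l') => collect (cond s (-c) c) l' (normalForm nf x)

/-- The test that all coefficients of a formal sum vanish. -/
def allZero : FSum → Bool
  | [] => true
  | (Int.ofNat 0, _) :: x => allZero x
  | _ => false

/-- The label with bits `p`, `q`, `r`, `s`. -/
def label (p q r s : Bool) : ℕ := Nat.bit p (Nat.bit q (Nat.bit r (Nat.bit s 0)))

/-- The word whose letters are the subsets of `{1, …, 8}` with binary codes `a`, `b`, `c`, `d`. -/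
def word (a b c d : ℕ) : List ℕ :=
  [0, 1, 2, 3, 4, 5, 6, 7].map fun i =>
    label (a.testBit i) (b.testBit i) (c.testBit i) (d.testBit i)

/-- The product of four formal sums of letters, multiplied by `n`. -/
def words (n : ℤ) (A B C D : List (ℤ × ℕ)) : FSum :=
  A.flatMap fun a => B.flatMap fun b => C.flatMap fun c => D.map fun d =>
    (n * a.1 * b.1 * c.1 * d.1, word a.2 b.2 c.2 d.2)

/-- The effect on labels of exchanging the first two letters. -/
def swapFirst (t : ℕ) : ℕ := label (t.testBit 1) (t.testBit 0) (t.testBit 2) (t.testBit 3)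

/-- The effect on labels of exchanging the last two letters. -/
def swapLast (t : ℕ) : ℕ := label (t.testBit 0) (t.testBit 1) (t.testBit 3) (t.testBit 2)

/-- Antisymmetrization in the first two letters. -/
def antisymFirst (x : FSum) : FSum := x ++ x.map fun p => (-p.1, p.2.map swapFirst)

/-- Symmetrization in the last two letters. -/
def symLast (x : FSum) : FSum := x ++ x.map fun p => (p.1, p.2.map swapLast)

variable {M : Type} [AddCommGroup M]

/-- Antisymmetry under the exchange of the labels in positions `k` and `k + 1`. -/
def AntisymmAt (g : List ℕ → M) (k : ℕ) : Prop :=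
  ∀ l₁ a b l₂, l₁.length = k → g (l₁ ++ b :: a :: l₂) = -g (l₁ ++ a :: b :: l₂)

lemma AntisymmAt.cons {g : List ℕ → M} {k : ℕ} (h : AntisymmAt g (k + 1)) (a : ℕ) :
    AntisymmAt (fun l => g (a :: l)) k :=
  fun l₁ b c l₂ hl => h (a :: l₁) b c l₂ (by simp [hl])

variable [Module ℚ M]

/-- The value of a formal sum of words. -/
def evalF (g : List ℕ → M) (x : FSum) : M := (x.map fun p => (p.1 : ℚ) • g p.2).sum

/-- The value of a formal sum of letters. -/
def evalL (v : ℕ → M) (x : List (ℤ × ℕ)) : M := (x.map fun p => (p.1 : ℚ) • v p.2).sum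

/-- The value of a signed word. -/
def evalSgn (g : List ℕ → M) : Option (Bool × List ℕ) → M
  | none => 0
  | some (s, l) => (cond s (-1) 1 : ℚ) • g l

lemma evalSgn_signedBind {g : List ℕ → M} {f : List ℕ → Option (Bool × List ℕ)}
    (hf : ∀ l, g l = evalSgn g (f l)) (x : Option (Bool × List ℕ)) :
    evalSgn g (signedBind x f) = evalSgn g x := by
  rcases x with _ | ⟨s, l⟩
  · rfl
  · have h := hf l
    simp only [signedBind]
    rcases hfl : f l with _ | ⟨s', l'⟩
    · rw [hfl] at h
      simp [evalSgn, h]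
    · rw [hfl] at h
      simp only [evalSgn, h, smul_smul]
      cases s <;> cases s' <;> simp

lemma AntisymmAt.eq_zero {g : List ℕ → M} {l₁ : List ℕ} (h : AntisymmAt g l₁.length)
    (a : ℕ) (l₂ : List ℕ) : g (l₁ ++ a :: a :: l₂) = 0 := by
  have h2 := h l₁ a a l₂ rfl
  rw [eq_neg_iff_add_eq_zero, ← two_smul ℚ] at h2
  exact (smul_eq_zero.1 h2).resolve_left two_ne_zero

lemma eq_evalSgn_insertSgn {g : List ℕ → M} (h : ∀ k, AntisymmAt g k) (a : ℕ) (l : List ℕ) :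
    g (a :: l) = evalSgn g (insertSgn a l) := by
  induction l generalizing g with
  | nil => simp [insertSgn, evalSgn]
  | cons b l ih =>
    have ih' := ih fun k => (h (k + 1)).cons b
    have hs : g (a :: b :: l) = -g (b :: a :: l) := h 0 [] b a l rfl
    rw [insertSgn]
    cases hab : Nat.blt a b
    · cases hba : Nat.blt b a
      · have e : a = b := by
          rw [← Bool.not_eq_true, Nat.blt_eq] at hab hba
          omega
        subst e
        exact AntisymmAt.eq_zero (l₁ := []) (h 0) a l
      · rw [hs, ih']
        rcases insertSgn a l with _ | ⟨s, l'⟩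
        · simp [evalSgn]
        · cases s <;> simp [evalSgn]
    · simp [evalSgn]

lemma eq_evalSgn_sortSgn {g : List ℕ → M} (h : ∀ k, AntisymmAt g k) (l : List ℕ) :
    g l = evalSgn g (sortSgn l) := by
  induction l generalizing g with
  | nil => simp [sortSgn, evalSgn]
  | cons a l ih =>
    have ih' := ih fun k => (h (k + 1)).cons a
    rw [ih', sortSgn]
    rcases sortSgn l with _ | ⟨s, l'⟩
    · rfl
    · have hi := eq_evalSgn_insertSgn h a l'
      simp only [evalSgn, signedBind, hi]
      rcases insertSgn a l' with _ | ⟨s', l''⟩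
      · simp
      · cases s <;> cases s' <;> simp

lemma eq_evalSgn_compareSwap {g : List ℕ → M} {k : ℕ} (h : AntisymmAt g k) (l : List ℕ) :
    g l = evalSgn g (compareSwap k l) := by
  induction k generalizing g l with
  | zero =>
    rcases l with _ | ⟨a, _ | ⟨b, l⟩⟩
    · simp [compareSwap, evalSgn]
    · simp [compareSwap, evalSgn]
    · rw [compareSwap]
      cases hab : Nat.blt a b
      · cases hba : Nat.blt b a
        · have e : a = b := by
            rw [← Bool.not_eq_true, Nat.blt_eq] at hab hba
            omega
          subst e
          exact AntisymmAt.eq_zero (l₁ := []) h a l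
        · have hs : g (a :: b :: l) = -g (b :: a :: l) := h [] b a l rfl
          simp [evalSgn, hs]
      · simp [evalSgn]
  | succ k ih =>
    rcases l with _ | ⟨a, l⟩
    · simp [compareSwap, evalSgn]
    · have hi := ih (h.cons a) l
      rw [hi, compareSwap]
      rcases compareSwap k l with _ | ⟨s, l'⟩ <;> simp [evalSgn]

lemma eq_evalSgn_pairSwap {g : List ℕ → M}
    (h : ∀ x₀ x₁ x₂ x₃ x₄ x₅ x₆ x₇,
      g [x₀, x₄, x₅, x₃, x₁, x₂, x₆, x₇] = g [x₀, x₁, x₂, x₃, x₄, x₅, x₆, x₇]) (l : List ℕ) :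
    g l = evalSgn g (pairSwap l) := by
  unfold pairSwap
  split
  · rename_i x₀ x₁ x₂ x₃ x₄ x₅ x₆ x₇
    cases Nat.blt (16 * x₄ + x₅) (16 * x₁ + x₂) <;> simp [evalSgn, h x₀ x₁ x₂ x₃ x₄ x₅ x₆ x₇]
  · simp [evalSgn]

lemma eq_evalSgn_quadricSgn {g : List ℕ → M} (h₁ : AntisymmAt g 1) (h₄ : AntisymmAt g 4)
    (h₆ : AntisymmAt g 6)
    (h : ∀ x₀ x₁ x₂ x₃ x₄ x₅ x₆ x₇,
      g [x₀, x₄, x₅, x₃, x₁, x₂, x₆, x₇] = g [x₀, x₁, x₂, x₃, x₄, x₅, x₆, x₇]) (l : List ℕ) :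
    g l = evalSgn g (quadricSgn l) := by
  rw [quadricSgn, evalSgn_signedBind, ← eq_evalSgn_compareSwap h₁]
  intro l
  rw [evalSgn_signedBind, ← eq_evalSgn_compareSwap h₄]
  intro l
  rw [evalSgn_signedBind (eq_evalSgn_pairSwap h), ← eq_evalSgn_compareSwap h₆]

lemma eq_of_listEq {l m : List ℕ} (h : listEq l m = true) : l = m := by
  induction l generalizing m with
  | nil => cases m <;> simp_all [listEq]
  | cons a l ih =>
    cases m with
    | nil => simp [listEq] at h
    | cons b m =>
      simp only [listEq, Bool.and_eq_true] at h
      rw [Nat.eq_of_beq_eq_true h.1, ih h.2]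

lemma evalF_cons (g : List ℕ → M) (c : ℤ) (l : List ℕ) (x : FSum) :
    evalF g ((c, l) :: x) = (c : ℚ) • g l + evalF g x := by
  simp [evalF]

lemma evalF_append (g : List ℕ → M) (x y : FSum) : evalF g (x ++ y) = evalF g x + evalF g y := by
  simp [evalF]

lemma evalF_collect (g : List ℕ → M) (c : ℤ) (l : List ℕ) (x : FSum) :
    evalF g (collect c l x) = (c : ℚ) • g l + evalF g x := by
  induction x with
  | nil => rfl
  | cons p x ih =>
    obtain ⟨d, m⟩ := p
    rw [collect]
    cases h : listEq l m
    · rw [cond_false, evalF_cons, ih, evalF_cons]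
      abel
    · rw [cond_true, evalF_cons, evalF_cons, eq_of_listEq h]
      push_cast
      rw [add_smul, add_assoc]

lemma evalF_normalForm {g : List ℕ → M} {nf : List ℕ → Option (Bool × List ℕ)}
    (h : ∀ l, g l = evalSgn g (nf l)) (x : FSum) : evalF g (normalForm nf x) = evalF g x := by
  induction x with
  | nil => rfl
  | cons p x ih =>
    obtain ⟨c, l⟩ := p
    have hl := h l
    rw [normalForm, evalF_cons]
    rcases hn : nf l with _ | ⟨s, l'⟩
    · rw [hn] at hl
      simp [hl, evalSgn, ih]
    · rw [hn] at hl
      rw [evalF_collect, ih, hl]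
      cases s <;> simp [evalSgn]

lemma evalF_eq_zero_of_allZero (g : List ℕ → M) {x : FSum} (h : allZero x = true) :
    evalF g x = 0 := by
  induction x with
  | nil => rfl
  | cons p x ih =>
    obtain ⟨c, l⟩ := p
    rw [evalF_cons]
    rcases c with (_ | n) | n
    · rw [ih h]
      simp
    · exact absurd h Bool.false_ne_true
    · exact absurd h Bool.false_ne_true

lemma evalF_antisymFirst {g : List ℕ → M} (h : ∀ l, g (l.map swapFirst) = -g l) (x : FSum) :
    evalF g (antisymFirst x) = (2 : ℚ) • evalF g x := by
  rw [antisymFirst, evalF_append, two_smul]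
  congr 1
  simp [evalF, Function.comp_def, h]

lemma evalF_symLast {g : List ℕ → M} (h : ∀ l, g (l.map swapLast) = g l) (x : FSum) :
    evalF g (symLast x) = (2 : ℚ) • evalF g x := by
  rw [symLast, evalF_append, two_smul]
  congr 1
  simp [evalF, Function.comp_def, h]

lemma evalL_cons (v : ℕ → M) (p : ℤ × ℕ) (x : List (ℤ × ℕ)) :
    evalL v (p :: x) = (p.1 : ℚ) • v p.2 + evalL v x := by
  simp [evalL]

lemma evalF_words {V : Type} [AddCommGroup V] [Module ℚ V]
    (Ψ : V →ₗ[ℚ] V →ₗ[ℚ] V →ₗ[ℚ] V →ₗ[ℚ] M) {g : List ℕ → M} {v w : ℕ → V}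
    (hg : ∀ a b c d, g (word a b c d) = Ψ (v a) (w b) (w c) (w d))
    (n : ℤ) (A B C D : List (ℤ × ℕ)) :
    evalF g (words n A B C D) =
      (n : ℚ) • Ψ (evalL v A) (evalL w B) (evalL w C) (evalL w D) := by
  have h₄ : ∀ (n : ℤ) a b c, evalF g (D.map fun d => (n * d.1, word a b c d.2)) =
      (n : ℚ) • Ψ (v a) (w b) (w c) (evalL w D) := by
    intro n a b c
    induction D with
    | nil => simp [evalF, evalL]
    | cons p D ih =>
      rw [List.map_cons, evalF_cons, ih, hg, evalL_cons]
      simp [smul_smul]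
  have h₃ : ∀ (n : ℤ) a b, evalF g (C.flatMap fun c => D.map fun d =>
      (n * c.1 * d.1, word a b c.2 d.2)) = (n : ℚ) • Ψ (v a) (w b) (evalL w C) (evalL w D) := by
    intro n a b
    induction C with
    | nil => simp [evalF, evalL]
    | cons p C ih =>
      rw [List.flatMap_cons, evalF_append, ih, h₄, evalL_cons]
      simp [smul_smul]
  have h₂ : ∀ (n : ℤ) a, evalF g (B.flatMap fun b => C.flatMap fun c => D.map fun d =>
      (n * b.1 * c.1 * d.1, word a b.2 c.2 d.2)) =
        (n : ℚ) • Ψ (v a) (evalL w B) (evalL w C) (evalL w D) := by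
    intro n a
    induction B with
    | nil => simp [evalF, evalL]
    | cons p B ih =>
      rw [List.flatMap_cons, evalF_append, ih, h₃, evalL_cons]
      simp [smul_smul]
  rw [words]
  induction A with
  | nil => simp [evalF, evalL]
  | cons p A ih =>
    rw [List.flatMap_cons, evalF_append, ih, h₂, evalL_cons]
    simp [smul_smul]

end FormalSums

section Words

variable {V M : Type} [AddCommGroup V] [AddCommGroup M] [Module ℚ V] [Module ℚ M]

lemma map_add_of_update {ι : Type} (τ : MultilinearMap ℚ (fun _ : ι => V) M) {f g h : ι → V}
    (i : ι) (hi : h i = f i + g i) (hf : ∀ j ≠ i, f j = h j) (hg : ∀ j ≠ i, g j = h j) :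
    τ h = τ f + τ g := by
  have e₁ : Function.update h i (f i) = f := by
    rw [Function.update_eq_iff]
    exact ⟨rfl, fun j hj => (hf j hj).symm⟩
  have e₂ : Function.update h i (g i) = g := by
    rw [Function.update_eq_iff]
    exact ⟨rfl, fun j hj => (hg j hj).symm⟩
  have e := τ.map_update_add h i (f i) (g i)
  rwa [← hi, Function.update_eq_self, e₁, e₂] at e

lemma map_smul_of_update {ι : Type} (τ : MultilinearMap ℚ (fun _ : ι => V) M) {f h : ι → V}
    (i : ι) {r : ℚ} (hi : h i = r • f i) (hf : ∀ j ≠ i, f j = h j) : τ h = r • τ f := by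
  have e₁ : Function.update h i (f i) = f := by
    rw [Function.update_eq_iff]
    exact ⟨rfl, fun j hj => (hf j hj).symm⟩
  have e := τ.map_update_smul h i r (f i)
  rwa [← hi, Function.update_eq_self, e₁] at e

/-- A multilinear map in four variables, in curried form. -/
def curryFour (τ : MultilinearMap ℚ (fun _ : Fin 4 => V) M) :
    V →ₗ[ℚ] V →ₗ[ℚ] V →ₗ[ℚ] V →ₗ[ℚ] M :=
  LinearMap.mk₂ ℚ
    (fun p q => LinearMap.mk₂ ℚ (fun a b => τ ![p, q, a, b])
      (fun _ _ _ => map_add_of_update τ 2 rfl (by simp [Fin.forall_fin_succ])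
        (by simp [Fin.forall_fin_succ]))
      (fun _ _ _ => map_smul_of_update τ 2 rfl (by simp [Fin.forall_fin_succ]))
      (fun _ _ _ => map_add_of_update τ 3 rfl (by simp [Fin.forall_fin_succ])
        (by simp [Fin.forall_fin_succ]))
      (fun _ _ _ => map_smul_of_update τ 3 rfl (by simp [Fin.forall_fin_succ])))
    (fun _ _ _ => LinearMap.ext₂ fun _ _ =>
      map_add_of_update τ 0 rfl (by simp [Fin.forall_fin_succ]) (by simp [Fin.forall_fin_succ]))
    (fun _ _ _ => LinearMap.ext₂ fun _ _ =>
      map_smul_of_update τ 0 rfl (by simp [Fin.forall_fin_succ]))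
    (fun _ _ _ => LinearMap.ext₂ fun _ _ =>
      map_add_of_update τ 1 rfl (by simp [Fin.forall_fin_succ]) (by simp [Fin.forall_fin_succ]))
    (fun _ _ _ => LinearMap.ext₂ fun _ _ =>
      map_smul_of_update τ 1 rfl (by simp [Fin.forall_fin_succ]))

/-- Antisymmetrization of a bilinear map. -/
def antisymBilin (W : V →ₗ[ℚ] V →ₗ[ℚ] M) : V →ₗ[ℚ] V →ₗ[ℚ] M := W - W.flip

/-- Antisymmetrization in the first two and symmetrization in the last two variables. -/
def wedgeOdotHom (τ : MultilinearMap ℚ (fun _ : Fin 4 => V) M) :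
    V →ₗ[ℚ] V →ₗ[ℚ] V →ₗ[ℚ] V →ₗ[ℚ] M :=
  (antisymBilin (curryFour τ)).compr₂ (LinearMap.id + LinearMap.lflip.toLinearMap)

lemma wedgeOdotHom_apply (τ : MultilinearMap ℚ (fun _ : Fin 4 => V) M) (p q a b : V) :
    wedgeOdotHom τ p q a b =
      τ ![p, q, a, b] - τ ![q, p, a, b] + (τ ![p, q, b, a] - τ ![q, p, b, a]) := rfl

lemma wedgeOdotHom_swapFirst (τ : MultilinearMap ℚ (fun _ : Fin 4 => V) M) (p q a b : V) :
    wedgeOdotHom τ q p a b = -wedgeOdotHom τ p q a b := by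
  simp only [wedgeOdotHom_apply]
  abel

lemma wedgeOdotHom_swapLast (τ : MultilinearMap ℚ (fun _ : Fin 4 => V) M) (p q a b : V) :
    wedgeOdotHom τ p q b a = wedgeOdotHom τ p q a b := by
  simp only [wedgeOdotHom_apply]
  abel

/-- The skew-symmetrization of `(p ⊗ q - q ⊗ p) ⊗ (a ⊙ b)`, as a multilinear expression. -/
def altWedgeOdot : VF K4 →ₗ[ℚ] VF K4 →ₗ[ℚ] VF K4 →ₗ[ℚ] VF K4 →ₗ[ℚ] TP K4 4 :=
  wedgeOdotHom ((altHom 4).compMultilinearMap (PiTensorProduct.tprod ℚ))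

lemma altHom_tprod_vmap (σ : Equiv.Perm (Fin 8)) (p q a b : VF K4) :
    (altHom 4).compMultilinearMap (PiTensorProduct.tprod ℚ)
        ![vmap (permAut 8 4 σ) p, vmap (permAut 8 4 σ) q, vmap (permAut 8 4 σ) a,
          vmap (permAut 8 4 σ) b] =
      ((Equiv.Perm.sign σ : ℤ) : ℚ) •
        (altHom 4).compMultilinearMap (PiTensorProduct.tprod ℚ) ![p, q, a, b] := by
  rw [LinearMap.compMultilinearMap_apply, LinearMap.compMultilinearMap_apply, altHom_apply,
    altHom_apply, ← Alt_tpMap, tpMap_tprod]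
  refine congrArg Alt (congrArg _ (funext fun i => ?_))
  fin_cases i <;> rfl

lemma altWedgeOdot_vmap (σ : Equiv.Perm (Fin 8)) (p q a b : VF K4) :
    altWedgeOdot (vmap (permAut 8 4 σ) p) (vmap (permAut 8 4 σ) q) (vmap (permAut 8 4 σ) a)
      (vmap (permAut 8 4 σ) b) = ((Equiv.Perm.sign σ : ℤ) : ℚ) • altWedgeOdot p q a b := by
  rw [altWedgeOdot, wedgeOdotHom_apply, wedgeOdotHom_apply, smul_add, smul_sub, smul_sub]
  simp only [altHom_tprod_vmap]

/-- The class of the bracket on the subset of `{1, …, 8}` with binary code `n`. -/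
def letter (n : ℕ) : VF K4 := br {i : Fin 8 | n.testBit i = true}

/-- The `k`-th letter of a word. -/
def slot (k : ℕ) (l : List ℕ) : VF K4 := br {i : Fin 8 | (l.getD i 0).testBit k = true}

/-- The value of a word, with a prescribed interpretation `z` of its first letter. -/
def wordVal (z : List ℕ → VF K4) (l : List ℕ) : TP K4 4 :=
  if l.length = 8 then altWedgeOdot (z l) (slot 1 l) (slot 2 l) (slot 3 l) else 0

lemma slot_perm {σ : Equiv.Perm (Fin 8)} {l l' : List ℕ}
    (h : ∀ i : Fin 8, l'.getD (σ i) 0 = l.getD i 0) (k : ℕ) :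
    slot k l' = vmap (permAut 8 4 σ) (slot k l) := by
  rw [slot, slot, vmap_br]
  congr 1
  ext i
  obtain ⟨j, rfl⟩ := σ.surjective i
  simp only [Set.mem_ofPred_eq, h, Set.mem_image, EmbeddingLike.apply_eq_iff_eq, exists_eq_right]

lemma wordVal_perm {z : List ℕ → VF K4} {σ : Equiv.Perm (Fin 8)} {l l' : List ℕ}
    (hl : l'.length = l.length) (h : ∀ i : Fin 8, l'.getD (σ i) 0 = l.getD i 0)
    (hz : z l' = vmap (permAut 8 4 σ) (z l)) :
    wordVal z l' = ((Equiv.Perm.sign σ : ℤ) : ℚ) • wordVal z l := by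
  unfold wordVal
  rw [hl]
  split_ifs
  · rw [hz, slot_perm h, slot_perm h, slot_perm h, altWedgeOdot_vmap]
  · rw [smul_zero]

lemma getD_swap_adjacent (l₁ : List ℕ) (a b : ℕ) (l₂ : List ℕ) {k : ℕ} (hk : l₁.length = k)
    (h₀ : k < 8) (h₁ : k + 1 < 8) (i : Fin 8) :
    (l₁ ++ b :: a :: l₂).getD (Equiv.swap (⟨k, h₀⟩ : Fin 8) ⟨k + 1, h₁⟩ i) 0 =
      (l₁ ++ a :: b :: l₂).getD i 0 := by
  subst hk
  rw [Equiv.swap_apply_def]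
  split_ifs with h h'
  · subst h
    simp [List.getD]
  · subst h'
    simp [List.getD]
  · have h2 : (i : ℕ) ≠ l₁.length := fun e => h (Fin.ext e)
    have h3 : (i : ℕ) ≠ l₁.length + 1 := fun e => h' (Fin.ext e)
    rcases lt_or_gt_of_ne h2 with hlt | hgt
    · simp [List.getD, List.getElem?_append_left hlt]
    · obtain ⟨j, hj⟩ : ∃ j, (i : ℕ) = l₁.length + (j + 2) := ⟨i - l₁.length - 2, by omega⟩
      simp [List.getD, hj, List.getElem?_append_right]

lemma antisymmAt_wordVal {z : List ℕ → VF K4} {k : ℕ}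
    (hz : ∀ (h₀ : k < 8) (h₁ : k + 1 < 8) (l l' : List ℕ),
      (∀ i : Fin 8, l'.getD (Equiv.swap (⟨k, h₀⟩ : Fin 8) ⟨k + 1, h₁⟩ i) 0 = l.getD i 0) →
      z l' = vmap (permAut 8 4 (Equiv.swap ⟨k, h₀⟩ ⟨k + 1, h₁⟩)) (z l)) :
    AntisymmAt (wordVal z) k := by
  intro l₁ a b l₂ hl
  by_cases h8 : (l₁ ++ a :: b :: l₂).length = 8
  · have h₁ : k + 1 < 8 := by
      simp only [List.length_append, List.length_cons] at h8
      omega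
    have h₀ : k < 8 := by omega
    have hs := getD_swap_adjacent l₁ a b l₂ hl h₀ h₁
    rw [wordVal_perm (by simp) hs (hz h₀ h₁ _ _ hs), Equiv.Perm.sign_swap (by simp)]
    simp
  · have h8' : (l₁ ++ b :: a :: l₂).length ≠ 8 := by
      simpa using h8
    rw [wordVal, wordVal, if_neg h8, if_neg h8', neg_zero]

lemma antisymmAt_wordVal_slot (k : ℕ) : AntisymmAt (wordVal (slot 0)) k :=
  antisymmAt_wordVal fun _ _ _ _ h => slot_perm h 0

lemma testBit_label (p q r s : Bool) :
    (label p q r s).testBit 0 = p ∧ (label p q r s).testBit 1 = q ∧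
      (label p q r s).testBit 2 = r ∧ (label p q r s).testBit 3 = s := by
  cases p <;> cases q <;> cases r <;> cases s <;> exact ⟨rfl, rfl, rfl, rfl⟩

lemma getD_word (a b c d : ℕ) (i : Fin 8) : (word a b c d).getD i 0 =
    label (a.testBit i) (b.testBit i) (c.testBit i) (d.testBit i) := by
  fin_cases i <;> rfl

lemma slot_word (a b c d : ℕ) :
    slot 0 (word a b c d) = letter a ∧ slot 1 (word a b c d) = letter b ∧
      slot 2 (word a b c d) = letter c ∧ slot 3 (word a b c d) = letter d := by
  simp only [slot, letter, getD_word, testBit_label, and_self]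

lemma wordVal_word {z : List ℕ → VF K4} (a b c d : ℕ) :
    wordVal z (word a b c d) =
      altWedgeOdot (z (word a b c d)) (letter b) (letter c) (letter d) := by
  rw [wordVal, if_pos (by rfl), (slot_word a b c d).2.1, (slot_word a b c d).2.2.1,
    (slot_word a b c d).2.2.2]

lemma getD_map_swapFirst (l : List ℕ) (i : ℕ) :
    (l.map swapFirst).getD i 0 = swapFirst (l.getD i 0) :=
  List.getD_map (d := 0) (f := swapFirst) ..

lemma getD_map_swapLast (l : List ℕ) (i : ℕ) :
    (l.map swapLast).getD i 0 = swapLast (l.getD i 0) :=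
  List.getD_map (d := 0) (f := swapLast) ..

lemma altWedgeOdot_swapFirst (p q a b : VF K4) :
    altWedgeOdot q p a b = -altWedgeOdot p q a b := by
  rw [altWedgeOdot, wedgeOdotHom_swapFirst]

lemma altWedgeOdot_swapLast (p q a b : VF K4) :
    altWedgeOdot p q b a = altWedgeOdot p q a b := by
  rw [altWedgeOdot, wedgeOdotHom_swapLast]

lemma wordVal_map_swapFirst (l : List ℕ) :
    wordVal (slot 0) (l.map swapFirst) = -wordVal (slot 0) l := by
  unfold wordVal
  rw [List.length_map]
  split_ifs
  · rw [← altWedgeOdot_swapFirst]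
    simp only [slot, getD_map_swapFirst, swapFirst, testBit_label]
  · rw [neg_zero]

lemma wordVal_map_swapLast {z : List ℕ → VF K4} (hz : ∀ l, z (l.map swapLast) = z l)
    (l : List ℕ) : wordVal z (l.map swapLast) = wordVal z l := by
  unfold wordVal
  rw [List.length_map]
  split_ifs
  · rw [hz, ← altWedgeOdot_swapLast]
    simp only [slot, getD_map_swapLast, swapLast, testBit_label]
  · rfl

lemma slot_zero_map_swapLast (l : List ℕ) : slot 0 (l.map swapLast) = slot 0 l := by
  simp only [slot, getD_map_swapLast, swapLast, testBit_label]

/-- A formal sum of words represents zero if it reduces to zero by permuting the vectors and the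
letters. -/
lemma evalF_slot_eq_zero {x : FSum}
    (h : allZero (normalForm sortSgn (antisymFirst (symLast (normalForm sortSgn x)))) = true) :
    evalF (wordVal (slot 0)) x = 0 := by
  have hn := eq_evalSgn_sortSgn antisymmAt_wordVal_slot
  have h0 := evalF_eq_zero_of_allZero (wordVal (slot 0)) h
  rw [evalF_normalForm hn, evalF_antisymFirst wordVal_map_swapFirst,
    evalF_symLast (wordVal_map_swapLast slot_zero_map_swapLast), evalF_normalForm hn] at h0
  simpa using h0

lemma evalF_words_slot (n : ℤ) (A B C D : List (ℤ × ℕ)) :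
    evalF (wordVal (slot 0)) (words n A B C D) =
      (n : ℚ) • altWedgeOdot (evalL letter A) (evalL letter B) (evalL letter C)
        (evalL letter D) :=
  evalF_words altWedgeOdot
    (fun a b c d => by rw [wordVal_word, (slot_word a b c d).1]) n A B C D

lemma evalF_words_const (q : VF K4) (n : ℤ) (B C D : List (ℤ × ℕ)) :
    evalF (wordVal fun _ => q) (words n [(1, 0)] B C D) =
      (n : ℚ) • altWedgeOdot q (evalL letter B) (evalL letter C) (evalL letter D) := by
  have h : evalL (fun _ : ℕ => q) [(1, 0)] = q := by simp [evalL]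
  have h' := evalF_words altWedgeOdot (g := wordVal fun _ => q) (v := fun _ => q) (w := letter)
    (fun a b c d => wordVal_word a b c d) n [(1, 0)] B C D
  rwa [h] at h'

lemma evalF_const_eq_zero {q : VF K4}
    (h₁ : vmap (permAut 8 4 (Equiv.swap 1 2)) q = q)
    (h₄ : vmap (permAut 8 4 (Equiv.swap 4 5)) q = q)
    (h₆ : vmap (permAut 8 4 (Equiv.swap 6 7)) q = q)
    (h : vmap (permAut 8 4 (Equiv.swap 1 4 * Equiv.swap 2 5)) q = q) {x : FSum}
    (hx : allZero (normalForm quadricSgn (symLast (normalForm quadricSgn x))) = true) :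
    evalF (wordVal fun _ => q) x = 0 := by
  have hn : ∀ l, wordVal (fun _ => q) l = evalSgn (wordVal fun _ => q) (quadricSgn l) := by
    refine eq_evalSgn_quadricSgn (antisymmAt_wordVal fun _ _ _ _ _ => h₁.symm)
      (antisymmAt_wordVal fun _ _ _ _ _ => h₄.symm)
      (antisymmAt_wordVal fun _ _ _ _ _ => h₆.symm) ?_
    intro x₀ x₁ x₂ x₃ x₄ x₅ x₆ x₇
    rw [wordVal_perm (l := [x₀, x₁, x₂, x₃, x₄, x₅, x₆, x₇])
      (l' := [x₀, x₄, x₅, x₃, x₁, x₂, x₆, x₇]) rfl ?_ h.symm,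
      Equiv.Perm.sign_mul, Equiv.Perm.sign_swap (by simp), Equiv.Perm.sign_swap (by simp)]
    · simp
    · intro i
      fin_cases i <;> simp [Equiv.swap_apply_def]
  have h0 := evalF_eq_zero_of_allZero (wordVal fun _ => q) hx
  rw [evalF_normalForm hn, evalF_symLast (wordVal_map_swapLast fun _ => rfl),
    evalF_normalForm hn] at h0
  simpa using h0

end Words

section Brackets

lemma dets_four (a b c d : Fin 8) : dets 8 4 ![a, b, c, d] =
    (gen 8 4 a 0 * gen 8 4 b 1 - gen 8 4 a 1 * gen 8 4 b 0) *
        (gen 8 4 c 2 * gen 8 4 d 3 - gen 8 4 c 3 * gen 8 4 d 2)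
      - (gen 8 4 a 0 * gen 8 4 b 2 - gen 8 4 a 2 * gen 8 4 b 0) *
        (gen 8 4 c 1 * gen 8 4 d 3 - gen 8 4 c 3 * gen 8 4 d 1)
      + (gen 8 4 a 0 * gen 8 4 b 3 - gen 8 4 a 3 * gen 8 4 b 0) *
        (gen 8 4 c 1 * gen 8 4 d 2 - gen 8 4 c 2 * gen 8 4 d 1)
      + (gen 8 4 a 1 * gen 8 4 b 2 - gen 8 4 a 2 * gen 8 4 b 1) *
        (gen 8 4 c 0 * gen 8 4 d 3 - gen 8 4 c 3 * gen 8 4 d 0)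
      - (gen 8 4 a 1 * gen 8 4 b 3 - gen 8 4 a 3 * gen 8 4 b 1) *
        (gen 8 4 c 0 * gen 8 4 d 2 - gen 8 4 c 2 * gen 8 4 d 0)
      + (gen 8 4 a 2 * gen 8 4 b 3 - gen 8 4 a 3 * gen 8 4 b 2) *
        (gen 8 4 c 0 * gen 8 4 d 1 - gen 8 4 c 1 * gen 8 4 d 0) := by
  unfold dets
  simp [Matrix.det_succ_row_zero, Fin.sum_univ_succ, Fin.succAbove]
  ring

/-- A three-term Plücker relation. -/
lemma plucker (a b c d x y : Fin 8) :
    dets 8 4 ![a, b, c, x] * dets 8 4 ![b, c, d, y]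
        - dets 8 4 ![b, c, d, x] * dets 8 4 ![a, b, c, y] =
      dets 8 4 ![a, b, c, d] * dets 8 4 ![b, c, x, y] := by
  simp only [dets_four]
  ring

lemma dets_swap_zero_one (a b c d : Fin 8) :
    dets 8 4 ![b, a, c, d] = -dets 8 4 ![a, b, c, d] := by
  simp only [dets_four]
  ring

lemma dets_swap_one_two (a b c d : Fin 8) :
    dets 8 4 ![a, c, b, d] = -dets 8 4 ![a, b, c, d] := by
  simp only [dets_four]
  ring

lemma permAut_dets_four (σ : Equiv.Perm (Fin 8)) (a b c d : Fin 8) :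
    permAut 8 4 σ (dets 8 4 ![a, b, c, d]) = dets 8 4 ![σ a, σ b, σ c, σ d] := by
  rw [permAut_dets]
  congr 1
  funext i
  fin_cases i <;> rfl

/-- The numerator of `ρ_{2,4}`. -/
def quadric : K4 :=
  dets 8 4 ![1, 2, 3, 6] * dets 8 4 ![3, 4, 5, 7] - dets 8 4 ![3, 4, 5, 6] * dets 8 4 ![1, 2, 3, 7]

lemma quadric_ne_zero : quadric ≠ 0 := by
  intro h0
  simp only [quadric, dets_eq_algebraMap, ← map_mul, ← map_sub] at h0
  have h1 := (IsFractionRing.injective (Pol 8 4) (FF 8 4)) (h0.trans (map_zero _).symm)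
  have h2 := congrArg (momentEval 8 4) h1
  simp only [map_sub, map_mul, map_zero, momentEval_polDets, Matrix.det_succ_row_zero] at h2
  simp [Fin.sum_univ_succ, Fin.succAbove, Matrix.vandermonde] at h2
  norm_num at h2

lemma vmap_cls_quadric_of_eq_neg {σ : Equiv.Perm (Fin 8)} (h : permAut 8 4 σ quadric = -quadric) :
    vmap (permAut 8 4 σ) (cls quadric) = cls quadric := by
  rw [vmap_cls, h, cls_neg]

lemma permAut_swap_one_two_quadric : permAut 8 4 (Equiv.swap 1 2) quadric = -quadric := by
  simp only [quadric, map_sub, map_mul, permAut_dets_four]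
  simp [Equiv.swap_apply_def]
  rw [dets_swap_zero_one 1 2 3 6, dets_swap_zero_one 1 2 3 7]
  ring

lemma permAut_swap_four_five_quadric : permAut 8 4 (Equiv.swap 4 5) quadric = -quadric := by
  simp only [quadric, map_sub, map_mul, permAut_dets_four]
  simp [Equiv.swap_apply_def]
  rw [dets_swap_one_two 3 4 5 6, dets_swap_one_two 3 4 5 7]
  ring

lemma permAut_swap_six_seven_quadric : permAut 8 4 (Equiv.swap 6 7) quadric = -quadric := by
  simp only [quadric, map_sub, map_mul, permAut_dets_four]
  simp [Equiv.swap_apply_def]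
  ring

lemma permAut_swap_mul_swap_quadric :
    permAut 8 4 (Equiv.swap 1 4 * Equiv.swap 2 5) quadric = -quadric := by
  simp only [quadric, map_sub, map_mul, permAut_dets_four]
  simp [Equiv.swap_apply_def]
  rw [dets_swap_one_two 4 3 5 6, dets_swap_zero_one 3 4 5 6, dets_swap_one_two 4 3 5 7,
    dets_swap_zero_one 3 4 5 7, dets_swap_zero_one 1 3 2 6, dets_swap_one_two 1 2 3 6,
    dets_swap_zero_one 1 3 2 7, dets_swap_one_two 1 2 3 7]
  ring

lemma evalF_quadric_eq_zero {x : FSum}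
    (h : allZero (normalForm quadricSgn (symLast (normalForm quadricSgn x))) = true) :
    evalF (wordVal fun _ => cls quadric) x = 0 :=
  evalF_const_eq_zero (vmap_cls_quadric_of_eq_neg permAut_swap_one_two_quadric)
    (vmap_cls_quadric_of_eq_neg permAut_swap_four_five_quadric)
    (vmap_cls_quadric_of_eq_neg permAut_swap_six_seven_quadric)
    (vmap_cls_quadric_of_eq_neg permAut_swap_mul_swap_quadric) h

lemma dets_four_ne_zero {a b c d : Fin 8} (hab : a < b) (hbc : b < c) (hcd : c < d) :
    dets 8 4 ![a, b, c, d] ≠ 0 := by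
  refine dets_ne_zero (StrictMono.injective (Fin.strictMono_iff_lt_succ.2 ?_))
  simp [Fin.forall_fin_succ, hab, hbc, hcd]

lemma cls_dets_four {a b c d : Fin 8} (n : ℕ) (hab : a < b) (hbc : b < c) (hcd : c < d)
    (h : ∀ i : Fin 8, n.testBit i = true ↔ i = a ∨ i = b ∨ i = c ∨ i = d) :
    cls (dets 8 4 ![a, b, c, d]) = letter n := by
  have hi : Function.Injective ![a, b, c, d] := by
    refine StrictMono.injective (Fin.strictMono_iff_lt_succ.2 ?_)
    simp [Fin.forall_fin_succ, hab, hbc, hcd]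
  rw [← br_range hi, letter]
  congr 1
  ext i
  simp only [Set.mem_range, Set.mem_ofPred_eq, h, Fin.exists_fin_succ]
  simp [eq_comm]

end Brackets

section Ratios

lemma letter_classes :
    cls (dets 8 4 ![0, 1, 2, 3]) = letter 15 ∧ cls (dets 8 4 ![1, 2, 3, 4]) = letter 30 ∧
    cls (dets 8 4 ![2, 3, 4, 5]) = letter 60 ∧ cls (dets 8 4 ![0, 1, 2, 6]) = letter 71 ∧
    cls (dets 8 4 ![1, 2, 3, 6]) = letter 78 ∧ cls (dets 8 4 ![3, 4, 5, 6]) = letter 120 ∧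
    cls (dets 8 4 ![0, 1, 2, 7]) = letter 135 ∧ cls (dets 8 4 ![1, 2, 3, 7]) = letter 142 ∧
    cls (dets 8 4 ![2, 3, 4, 7]) = letter 156 ∧ cls (dets 8 4 ![3, 4, 5, 7]) = letter 184 ∧
    cls (dets 8 4 ![1, 2, 6, 7]) = letter 198 ∧ cls (dets 8 4 ![2, 3, 6, 7]) = letter 204 ∧
    cls (dets 8 4 ![3, 4, 6, 7]) = letter 216 := by
  refine ⟨?_, ?_, ?_, ?_, ?_, ?_, ?_, ?_, ?_, ?_, ?_, ?_, ?_⟩ <;>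
  · refine cls_dets_four _ (by simp) (by simp) (by simp) fun i => ?_
    fin_cases i <;> simp [Nat.testBit]

lemma rho_eq_div :
    rho 1 = dets 8 4 ![0, 1, 2, 6] / dets 8 4 ![0, 1, 2, 7] ∧
    rho 2 = dets 8 4 ![1, 2, 3, 6] / dets 8 4 ![1, 2, 3, 7] ∧
    rho 3 = dets 8 4 ![2, 3, 4, 6] / dets 8 4 ![2, 3, 4, 7] ∧
    rho 4 = dets 8 4 ![3, 4, 5, 6] / dets 8 4 ![3, 4, 5, 7] := ⟨rfl, rfl, rfl, rfl⟩

/-- The difference of two neighbouring ratios. -/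
lemma div_sub_div_dets {a b c d x y : Fin 8} (h : dets 8 4 ![a, b, c, y] ≠ 0)
    (h' : dets 8 4 ![b, c, d, y] ≠ 0) :
    dets 8 4 ![a, b, c, x] / dets 8 4 ![a, b, c, y]
        - dets 8 4 ![b, c, d, x] / dets 8 4 ![b, c, d, y] =
      dets 8 4 ![a, b, c, d] * dets 8 4 ![b, c, x, y] /
        (dets 8 4 ![a, b, c, y] * dets 8 4 ![b, c, d, y]) := by
  rw [div_sub_div _ _ h h', ← plucker a b c d x y,
    mul_comm (dets 8 4 ![a, b, c, y]) (dets 8 4 ![b, c, d, x])]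

lemma cls_div_sub_div_dets {a b c d x y : Fin 8} (hab : a < b) (hbc : b < c) (hcd : c < d)
    (hdx : d < x) (hxy : x < y) :
    dets 8 4 ![a, b, c, x] / dets 8 4 ![a, b, c, y]
        - dets 8 4 ![b, c, d, x] / dets 8 4 ![b, c, d, y] ≠ 0 ∧
    cls (dets 8 4 ![a, b, c, x] / dets 8 4 ![a, b, c, y]
        - dets 8 4 ![b, c, d, x] / dets 8 4 ![b, c, d, y]) =
      cls (dets 8 4 ![a, b, c, d]) + cls (dets 8 4 ![b, c, x, y])
        - (cls (dets 8 4 ![a, b, c, y]) + cls (dets 8 4 ![b, c, d, y])) := by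
  have hcx := hcd.trans hdx
  have h₁ := dets_four_ne_zero hab hbc (hcx.trans hxy)
  have h₂ := dets_four_ne_zero hbc hcd (hdx.trans hxy)
  have h₃ := dets_four_ne_zero hab hbc hcd
  have h₄ := dets_four_ne_zero hbc hcx hxy
  rw [div_sub_div_dets h₁ h₂]
  exact ⟨div_ne_zero (mul_ne_zero h₃ h₄) (mul_ne_zero h₁ h₂),
    by rw [cls_div (mul_ne_zero h₃ h₄) (mul_ne_zero h₁ h₂), cls_mul h₃ h₄, cls_mul h₁ h₂]⟩

lemma rr_two_four_eq : rr 2 4 =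
    quadric / (dets 8 4 ![1, 2, 3, 7] * dets 8 4 ![3, 4, 5, 7]) := by
  rw [rr, rho_eq_div.2.1, rho_eq_div.2.2.2,
    div_sub_div _ _ (dets_four_ne_zero (by simp) (by simp) (by simp))
      (dets_four_ne_zero (by simp) (by simp) (by simp)), quadric]
  ring

lemma rho_ne_zero : rho 1 ≠ 0 ∧ rho 2 ≠ 0 ∧ rho 4 ≠ 0 := by
  rw [rho_eq_div.1, rho_eq_div.2.1, rho_eq_div.2.2.2]
  refine ⟨?_, ?_, ?_⟩ <;>
  exact div_ne_zero (dets_four_ne_zero (by simp) (by simp) (by simp))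
    (dets_four_ne_zero (by simp) (by simp) (by simp))

lemma cls_rho :
    cls (rho 1) = letter 71 - letter 135 ∧ cls (rho 2) = letter 78 - letter 142 ∧
      cls (rho 4) = letter 120 - letter 184 := by
  obtain ⟨-, -, -, h71, h78, h120, h135, h142, -, h184, -, -, -⟩ := letter_classes
  rw [rho_eq_div.1, rho_eq_div.2.1, rho_eq_div.2.2.2, ← h71, ← h135, ← h78, ← h142, ← h120, ← h184]
  refine ⟨?_, ?_, ?_⟩ <;>
  exact cls_div (dets_four_ne_zero (by simp) (by simp) (by simp))
    (dets_four_ne_zero (by simp) (by simp) (by simp))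

lemma rr_ne_zero : rr 1 2 ≠ 0 ∧ rr 2 3 ≠ 0 ∧ rr 3 4 ≠ 0 ∧ rr 2 4 ≠ 0 := by
  refine ⟨?_, ?_, ?_, ?_⟩
  · exact (cls_div_sub_div_dets (a := 0) (b := 1) (c := 2) (d := 3) (x := 6) (y := 7)
      (by simp) (by simp) (by simp) (by simp) (by simp)).1
  · exact (cls_div_sub_div_dets (a := 1) (b := 2) (c := 3) (d := 4) (x := 6) (y := 7)
      (by simp) (by simp) (by simp) (by simp) (by simp)).1
  · exact (cls_div_sub_div_dets (a := 2) (b := 3) (c := 4) (d := 5) (x := 6) (y := 7)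
      (by simp) (by simp) (by simp) (by simp) (by simp)).1
  · rw [rr_two_four_eq]
    exact div_ne_zero quadric_ne_zero
      (mul_ne_zero (dets_four_ne_zero (by simp) (by simp) (by simp))
        (dets_four_ne_zero (by simp) (by simp) (by simp)))

lemma cls_rr :
    cls (rr 1 2) = letter 15 + letter 198 - (letter 135 + letter 142) ∧
    cls (rr 2 3) = letter 30 + letter 204 - (letter 142 + letter 156) ∧
    cls (rr 3 4) = letter 60 + letter 216 - (letter 156 + letter 184) ∧
    cls (rr 2 4) = cls quadric - (letter 142 + letter 184) := by
  obtain ⟨h15, h30, h60, -, -, -, h135, h142, h156, h184, h198, h204, h216⟩ := letter_classes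
  rw [← h15, ← h30, ← h60, ← h135, ← h142, ← h156, ← h184, ← h198, ← h204, ← h216]
  refine ⟨?_, ?_, ?_, ?_⟩
  · exact (cls_div_sub_div_dets (a := 0) (b := 1) (c := 2) (d := 3) (x := 6) (y := 7)
      (by simp) (by simp) (by simp) (by simp) (by simp)).2
  · exact (cls_div_sub_div_dets (a := 1) (b := 2) (c := 3) (d := 4) (x := 6) (y := 7)
      (by simp) (by simp) (by simp) (by simp) (by simp)).2
  · exact (cls_div_sub_div_dets (a := 2) (b := 3) (c := 4) (d := 5) (x := 6) (y := 7)
      (by simp) (by simp) (by simp) (by simp) (by simp)).2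
  · have h := dets_four_ne_zero (a := 1) (b := 2) (c := 3) (d := 7) (by simp) (by simp) (by simp)
    have h' := dets_four_ne_zero (a := 3) (b := 4) (c := 5) (d := 7) (by simp) (by simp) (by simp)
    rw [rr_two_four_eq, cls_div quadric_ne_zero (mul_ne_zero h h'), cls_mul h h']

lemma cls_rr_swap (i j : ℕ) : cls (rr i j) = cls (rr j i) := cls_sub_comm _ _

lemma rr_swap_ne_zero {i j : ℕ} (h : rr i j ≠ 0) : rr j i ≠ 0 :=
  sub_ne_zero.2 (sub_ne_zero.1 h).symm

lemma one_sub_rr_div : 1 - rr 2 4 / rr 3 4 = rr 3 2 / rr 3 4 := by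
  rw [eq_div_iff rr_ne_zero.2.2.1, sub_mul, div_mul_cancel₀ _ rr_ne_zero.2.2.1, one_mul]
  simp only [rr]
  ring

lemma one_sub_rho_div : 1 - rho 1 / rho 2 = rr 2 1 / rho 2 := by
  rw [eq_div_iff rho_ne_zero.2.1, sub_mul, div_mul_cancel₀ _ rho_ne_zero.2.1, one_mul, rr]

/-- The bracket factors of `ρ_{2,4} / ρ_{3,4}`. -/
def ratioTwoFour : List (ℤ × ℕ) := [(1, 156), (-1, 142), (-1, 60), (-1, 216)]

/-- The bracket factors of `ρ_{3,2} / ρ_{3,4}`. -/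
def ratioThreeTwo : List (ℤ × ℕ) :=
  [(1, 30), (1, 204), (1, 184), (-1, 142), (-1, 60), (-1, 216)]

/-- The bracket factors of `ρ_4 / ρ_1`. -/
def rhoFourOne : List (ℤ × ℕ) := [(1, 120), (1, 135), (-1, 184), (-1, 71)]

/-- The bracket factors of `ρ_2 / ρ_{2,1}`. -/
def rhoTwoDiff : List (ℤ × ℕ) := [(1, 78), (1, 135), (-1, 15), (-1, 198)]

/-- The bracket factors of `ρ_{1,2}`. -/
def diffOneTwo : List (ℤ × ℕ) := [(1, 15), (1, 198), (-1, 135), (-1, 142)]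

/-- The bracket factors of `ρ_1 / ρ_{1,2}`. -/
def rhoOneDiff : List (ℤ × ℕ) := [(1, 71), (1, 142), (-1, 15), (-1, 198)]

/-- The bracket factors of `ρ_{2,3}`. -/
def diffTwoThree : List (ℤ × ℕ) := [(1, 30), (1, 204), (-1, 142), (-1, 156)]

/-- The bracket factors of `ρ_{3,4}`. -/
def diffThreeFour : List (ℤ × ℕ) := [(1, 60), (1, 216), (-1, 156), (-1, 184)]

/-- The bracket factors of `ρ_1 / ρ_2`. -/
def rhoOneTwo : List (ℤ × ℕ) := [(1, 71), (1, 142), (-1, 135), (-1, 78)]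

/-- The bracket factors of `ρ_{2,1} / ρ_2`. -/
def diffRhoTwo : List (ℤ × ℕ) := [(1, 15), (1, 198), (-1, 135), (-1, 78)]

lemma cls_rr_div_rr :
    cls (rr 2 4 / rr 3 4) = cls quadric + evalL letter ratioTwoFour ∧
    cls (rr 3 2 / rr 3 4) = evalL letter ratioThreeTwo := by
  obtain ⟨-, h23, h34, h24⟩ := rr_ne_zero
  obtain ⟨-, e23, e34, e24⟩ := cls_rr
  rw [cls_div h24 h34, cls_div (rr_swap_ne_zero h23) h34, cls_rr_swap 3 2, e23, e34, e24]
  simp only [evalL, ratioTwoFour, ratioThreeTwo, List.map_cons, List.map_nil, List.sum_cons,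
    List.sum_nil, Int.cast_one, Int.cast_neg, one_smul, neg_smul]
  constructor <;> abel

lemma cls_rr_eq :
    cls (rr 1 2) = evalL letter diffOneTwo ∧ cls (rr 3 2) = evalL letter diffTwoThree ∧
    cls (rr 3 4) = evalL letter diffThreeFour := by
  obtain ⟨e12, e23, e34, -⟩ := cls_rr
  rw [cls_rr_swap 3 2, e12, e23, e34]
  simp only [evalL, diffOneTwo, diffTwoThree, diffThreeFour, List.map_cons, List.map_nil,
    List.sum_cons, List.sum_nil, Int.cast_one, Int.cast_neg, one_smul, neg_smul]
  refine ⟨?_, ?_, ?_⟩ <;> abel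

lemma cls_rho_div :
    cls (rho 4 / rho 1) = evalL letter rhoFourOne ∧
    cls (rho 2 / rr 2 1) = evalL letter rhoTwoDiff ∧
    cls (rho 1 / rr 1 2) = evalL letter rhoOneDiff ∧
    cls (rho 1 / rho 2) = evalL letter rhoOneTwo ∧
    cls (rr 2 1 / rho 2) = evalL letter diffRhoTwo := by
  obtain ⟨n1, n2, n4⟩ := rho_ne_zero
  obtain ⟨e1, e2, e4⟩ := cls_rho
  have h12 := rr_ne_zero.1
  have h21 := rr_swap_ne_zero h12
  rw [cls_div n4 n1, cls_div n2 h21, cls_div n1 h12, cls_div n1 n2, cls_div h21 n2,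
    cls_rr_swap 2 1, cls_rr.1, e1, e2, e4]
  simp only [evalL, rhoFourOne, rhoTwoDiff, rhoOneDiff, rhoOneTwo, diffRhoTwo, List.map_cons,
    List.map_nil, List.sum_cons, List.sum_nil, Int.cast_one, Int.cast_neg, one_smul, neg_smul]
  refine ⟨?_, ?_, ?_, ?_, ?_⟩ <;> abel

end Ratios

section Identities

lemma map_wedgeOdot {F : Type} [Field F] (φ : TP F 4 →ₗ[ℚ] TP F 4) (p q a b : VF F) :
    φ (PiTensorProduct.tprod ℚ ![p, q, a, b] - PiTensorProduct.tprod ℚ ![q, p, a, b]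
        + (PiTensorProduct.tprod ℚ ![p, q, b, a] - PiTensorProduct.tprod ℚ ![q, p, b, a])) =
      wedgeOdotHom (φ.compMultilinearMap (PiTensorProduct.tprod ℚ)) p q a b := by
  rw [map_add, map_sub, map_sub]
  rfl

lemma Alt_lodot (u a b : K4) :
    Alt (lodot u a b) = altWedgeOdot (cls u) (cls (1 - u)) (cls a) (cls b) := by
  rw [altWedgeOdot, ← map_wedgeOdot, altHom_apply]
  exact congrArg Alt (by rfl)

variable {N m : ℕ} (Ψ : VF (FF N m) →ₗ[ℚ] VF (FF N m) →ₗ[ℚ] VF (FF N m) →ₗ[ℚ] VF (FF N m) →ₗ[ℚ]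
  TP (FF N m) 4)

lemma Alt_eq_of_split_first {q u y a b c d r u' y' : VF (FF N m)} {X Y Z W : TP (FF N m) 4}
    (hX : Alt X = Ψ (q + u) y a y) (hY : Alt Y = Ψ (q + u) y y b) (hZ : Alt Z = Ψ (q + u) y c a)
    (hW : Alt W = Ψ u' y' d r)
    (hu : ((1 : ℤ) : ℚ) • Ψ u y a y + ((-2 : ℤ) : ℚ) • Ψ u y y b + ((3 : ℤ) : ℚ) • Ψ u y c a
      + ((-2 : ℤ) : ℚ) • Ψ u' y' d r = 0)
    (hq : ((1 : ℤ) : ℚ) • Ψ q y a y + ((-2 : ℤ) : ℚ) • Ψ q y y b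
      + ((3 : ℤ) : ℚ) • Ψ q y c a = 0) :
    Alt (X - (2 : ℚ) • Y + (3 : ℚ) • Z) = (2 : ℚ) • Alt W := by
  rw [← altHom_apply] at hX hY hZ hW
  rw [← altHom_apply, ← altHom_apply, map_add, map_sub, map_smul, map_smul, hX, hY, hZ, hW]
  simp only [map_add, LinearMap.add_apply]
  push_cast at hu hq
  linear_combination (norm := module) hu + hq

lemma Alt_eq_zero_of_split_second {q u y b d r s u' y' : VF (FF N m)} {X Y Z : TP (FF N m) 4}
    (hX : Alt X = Ψ (q + u) y b d) (hY : Alt Y = Ψ u' y' s s) (hZ : Alt Z = Ψ u' y' r r)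
    (hu : ((-2 : ℤ) : ℚ) • Ψ u y b d + ((1 : ℤ) : ℚ) • Ψ u' y' s s
      + ((-1 : ℤ) : ℚ) • Ψ u' y' r r = 0)
    (hq : ((-1 : ℤ) : ℚ) • Ψ q y b d = 0) :
    Alt (-X + (2 : ℚ)⁻¹ • Y - (2 : ℚ)⁻¹ • Z) = 0 := by
  rw [← altHom_apply] at hX hY hZ
  rw [← altHom_apply, map_sub, map_add, map_neg, map_smul, map_smul, hX, hY, hZ]
  simp only [map_add, LinearMap.add_apply]
  push_cast at hu hq
  linear_combination (norm := module) (2 : ℚ)⁻¹ • hu + hq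

/-- The terms of the first identity without the quadric factor. -/
def firstSum : FSum :=
  words 1 ratioTwoFour ratioThreeTwo rhoFourOne ratioThreeTwo ++
    words (-2) ratioTwoFour ratioThreeTwo ratioThreeTwo rhoTwoDiff ++
    words 3 ratioTwoFour ratioThreeTwo diffOneTwo rhoFourOne ++
    words (-2) rhoOneTwo diffRhoTwo rhoOneDiff diffTwoThree

/-- The terms of the first identity with the quadric factor. -/
def firstQuadricSum : FSum :=
  words 1 [(1, 0)] ratioThreeTwo rhoFourOne ratioThreeTwo ++
    words (-2) [(1, 0)] ratioThreeTwo ratioThreeTwo rhoTwoDiff ++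
    words 3 [(1, 0)] ratioThreeTwo diffOneTwo rhoFourOne

/-- Twice the terms of the second identity without the quadric factor. -/
def secondSum : FSum :=
  words (-2) ratioTwoFour ratioThreeTwo rhoTwoDiff rhoOneDiff ++
    words 1 rhoOneTwo diffRhoTwo diffThreeFour diffThreeFour ++
    words (-1) rhoOneTwo diffRhoTwo diffTwoThree diffTwoThree

/-- The terms of the second identity with the quadric factor. -/
def secondQuadricSum : FSum :=
  words (-1) [(1, 0)] ratioThreeTwo rhoTwoDiff rhoOneDiff

/-- Kernel computations need the computable instance instead of the classical one. -/
local instance computableDecidableEqBool : DecidableEq Bool := instDecidableEqBool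

lemma allZero_firstSum :
    allZero (normalForm sortSgn (antisymFirst (symLast (normalForm sortSgn firstSum)))) = true := by
  decide +kernel

lemma allZero_firstQuadricSum :
    allZero (normalForm quadricSgn (symLast (normalForm quadricSgn firstQuadricSum))) = true := by
  decide +kernel

lemma allZero_secondSum :
    allZero (normalForm sortSgn (antisymFirst (symLast (normalForm sortSgn secondSum)))) =
      true := by
  decide +kernel

lemma allZero_secondQuadricSum :
    allZero (normalForm quadricSgn (symLast (normalForm quadricSgn secondQuadricSum))) = true := by
  decide +kernel

end Identities

end GrassPoly

end

/-- the symmetric-part lemma: two identities in `V_F^{⊗4}`. -/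
theorem symmetric_part_identities :
    (Alt (lodot (rr 2 4 / rr 3 4) (rho 4 / rho 1) (rr 3 2 / rr 3 4)
        - (2 : ℚ) • lodot (rr 2 4 / rr 3 4) (rr 3 2 / rr 3 4) (rho 2 / rr 2 1)
        + (3 : ℚ) • lodot (rr 2 4 / rr 3 4) (rr 1 2) (rho 4 / rho 1)) =
      (2 : ℚ) • Alt (lodot (rho 1 / rho 2) (rho 1 / rr 1 2) (rr 3 2))) ∧
    (Alt (- lodot (rr 2 4 / rr 3 4) (rho 2 / rr 2 1) (rho 1 / rr 1 2)
        + (2 : ℚ)⁻¹ • lodot (rho 1 / rho 2) (rr 3 4) (rr 3 4)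
        - (2 : ℚ)⁻¹ • lodot (rho 1 / rho 2) (rr 3 2) (rr 3 2)) = 0) := by
  obtain ⟨hu, hy⟩ := cls_rr_div_rr
  obtain ⟨hc, hr, hs⟩ := cls_rr_eq
  obtain ⟨ha, hb, hd, hu', hy'⟩ := cls_rho_div
  have e₁ := evalF_slot_eq_zero allZero_firstSum
  have q₁ := evalF_quadric_eq_zero allZero_firstQuadricSum
  have e₂ := evalF_slot_eq_zero allZero_secondSum
  have q₂ := evalF_quadric_eq_zero allZero_secondQuadricSum
  rw [firstSum, evalF_append, evalF_append, evalF_append] at e₁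
  rw [firstQuadricSum, evalF_append, evalF_append] at q₁
  rw [secondSum, evalF_append, evalF_append] at e₂
  rw [secondQuadricSum] at q₂
  simp only [evalF_words_slot] at e₁ e₂
  simp only [evalF_words_const] at q₁ q₂
  constructor
  · refine Alt_eq_of_split_first altWedgeOdot ?_ ?_ ?_ ?_ e₁ q₁
    · rw [Alt_lodot, one_sub_rr_div, hu, hy, ha]
    · rw [Alt_lodot, one_sub_rr_div, hu, hy, hb]
    · rw [Alt_lodot, one_sub_rr_div, hu, hy, hc, ha]
    · rw [Alt_lodot, one_sub_rho_div, hu', hy', hd, hr]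
  · refine Alt_eq_zero_of_split_second altWedgeOdot ?_ ?_ ?_ e₂ q₂
    · rw [Alt_lodot, one_sub_rr_div, hu, hy, hb, hd]
    · rw [Alt_lodot, one_sub_rho_div, hu', hy', hs]
    · rw [Alt_lodot, one_sub_rho_div, hu', hy', hr]
end

section
/- Let F = ℚ(x, y) be the rational function field in two variables. For all σ ∈ S_3, S^⧢ Ĩ^+_{4,1}(x^σ, y) = sgn(σ) · S^⧢ Ĩ^+_{4,1}(x, y), and S^⧢ Ĩ^+_{4,1}(x, y^{−1}) = S^⧢ Ĩ^+_{4,1}(x, y) in V_F^{⊗5}. -/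
open scoped TensorProduct
open PiTensorProduct

attribute [local instance] Classical.propDecidable

set_option maxHeartbeats 1000000
set_option synthInstance.maxHeartbeats 400000

namespace GrassPoly

noncomputable section TwoVar

/-- The rational function field `ℚ(x, y)`. -/
abbrev K2 : Type := FractionRing (MvPolynomial (Fin 2) ℚ)

/-- The variable `x`. -/
def xx : K2 := algebraMap (MvPolynomial (Fin 2) ℚ) K2 (MvPolynomial.X 0)

/-- The variable `y`. -/
def yy : K2 := algebraMap (MvPolynomial (Fin 2) ℚ) K2 (MvPolynomial.X 1)

end TwoVar

end GrassPoly

open GrassPoly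

namespace GrassPoly

lemma I41p_inv_right {F : Type} [Field F] (x y : F) : I41p x y⁻¹ = I41p x y := by
  rw [I41p, I41p, inv_inv, add_comm]

lemma tI41p_inv_right {F : Type} [Field F] (x y : F) : tI41p x y⁻¹ = tI41p x y := by
  simp only [tI41p, I41p_inv_right]

lemma tI41p_inv_left {F : Type} [Field F] {x : F} (h0 : x ≠ 0) (y : F) :
    tI41p x⁻¹ y = (-1 : ℚ) • tI41p x y := by
  have e1 : (1 - x⁻¹)⁻¹ = x / (x - 1) := by
    rw [← inv_div, sub_div, div_self h0, one_div]
  have e2 : x⁻¹ / (x⁻¹ - 1) = (1 - x)⁻¹ := by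
    rw [← inv_div, sub_div, div_self (inv_ne_zero h0), one_div, inv_inv]
  simp only [tI41p, anhList, List.map_cons, List.map_nil, List.sum_cons, List.sum_nil, inv_inv,
    e1, e2]
  module

lemma tI41p_one_sub_left {F : Type} [Field F] {x : F} (h0 : x ≠ 0) (h1 : x ≠ 1) (y : F) :
    tI41p (1 - x) y = (-1 : ℚ) • tI41p x y := by
  have h3 : x - 1 ≠ 0 := sub_ne_zero.mpr h1
  have e1 : 1 - (1 - x)⁻¹ = x / (x - 1) := by
    rw [← neg_sub x 1, inv_neg]
    field_simp
    ring
  have e2 : (1 - x) / (1 - x - 1) = 1 - x⁻¹ := by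
    rw [sub_right_comm, sub_self, zero_sub, div_neg]
    field_simp
    ring
  simp only [tI41p, anhList, List.map_cons, List.map_nil, List.sum_cons, List.sum_nil,
    sub_sub_cancel, e1, e2]
  module

/-- `Ĩ⁺_{4,1}` transforms by the sign character under the anharmonic action. -/
lemma tI41p_anharmonic {F : Type} [Field F] {x : F} (h0 : x ≠ 0) (h1 : x ≠ 1) (y : F)
    {p : ℚ × F} (hp : p ∈ anhList x) : tI41p p.2 y = p.1 • tI41p x y := by
  have h2 : 1 - x ≠ 0 := sub_ne_zero.mpr h1.symm
  have hi0 : x⁻¹ ≠ 0 := inv_ne_zero h0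
  have hi1 : x⁻¹ ≠ 1 := inv_ne_one.mpr h1
  have hq : 1 - x⁻¹ ≠ 0 := sub_ne_zero.mpr hi1.symm
  have e : x / (x - 1) = (1 - x⁻¹)⁻¹ := by
    rw [← inv_div, sub_div, div_self h0, one_div]
  simp only [anhList, List.mem_cons, List.not_mem_nil, or_false] at hp
  rcases hp with rfl | rfl | rfl | rfl | rfl | rfl
  · exact (one_smul ℚ _).symm
  · rw [tI41p_inv_left h2, tI41p_one_sub_left h0 h1, smul_smul]
    norm_num
  · rw [tI41p_one_sub_left hi0 hi1, tI41p_inv_left h0, smul_smul]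
    norm_num
  · exact tI41p_inv_left h0 y
  · exact tI41p_one_sub_left h0 h1 y
  · rw [e, tI41p_inv_left hq, tI41p_one_sub_left hi0 hi1,
      tI41p_inv_left h0, smul_smul, smul_smul]
    norm_num

lemma xx_ne_zero : xx ≠ 0 := by
  rw [xx, Ne, FaithfulSMul.algebraMap_eq_zero_iff]
  exact MvPolynomial.X_ne_zero 0

lemma xx_ne_one : xx ≠ 1 := by
  rw [xx, Ne, FaithfulSMul.algebraMap_eq_one_iff]
  intro h
  simpa using congrArg MvPolynomial.constantCoeff h

end GrassPoly

/-- Proposition `i41tilde`, symmetries: `Ĩ⁺_{4,1}` transforms by `sgn(σ)`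
under the anharmonic action on the first argument, and is invariant under inversion of the
second argument. -/
theorem i41ptilde_symmetries :
    (∀ p ∈ anhList xx, Pit 5 (tI41p p.2 yy) = p.1 • Pit 5 (tI41p xx yy)) ∧
      Pit 5 (tI41p xx yy⁻¹) = Pit 5 (tI41p xx yy) := by
  refine ⟨fun p hp => ?_, by rw [tI41p_inv_right]⟩
  rw [tI41p_anharmonic xx_ne_zero xx_ne_one yy hp, map_smul]
end
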